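/- Let g be an isometry of order 2 of the lattice 𝐋 = 3U ⊕ 2E8 ⊕ A2 acting non-trivially on the discriminant group 𝐋^♯, and suppose that the coinvariant sublattice 𝐋_g is negative definite and contains no vector of square -2 and no vector of square -4. Then 𝐋_g has rank 1 and is generated by a vector v with v·v = -6. -/

import Mathlib

open Matrix

/-- Gram matrix of the lattice `𝐋 = 3U ⊕ 2E8 ⊕ A2` (with `E8` negative definite):
three hyperbolic blocks, two copies of the negative definite `E8` Gram matrix,
and the `A2` block `!![-2,1;1,-2]`. -/
def LGram : Matrix (Fin 24) (Fin 24) ℤ :=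
  !![0, 1, 0, 0, 0, 0, 0, 0, 0, 0, 0, 0, 0, 0, 0, 0, 0, 0, 0, 0, 0, 0, 0, 0;
    1, 0, 0, 0, 0, 0, 0, 0, 0, 0, 0, 0, 0, 0, 0, 0, 0, 0, 0, 0, 0, 0, 0, 0;
    0, 0, 0, 1, 0, 0, 0, 0, 0, 0, 0, 0, 0, 0, 0, 0, 0, 0, 0, 0, 0, 0, 0, 0;
    0, 0, 1, 0, 0, 0, 0, 0, 0, 0, 0, 0, 0, 0, 0, 0, 0, 0, 0, 0, 0, 0, 0, 0;
    0, 0, 0, 0, 0, 1, 0, 0, 0, 0, 0, 0, 0, 0, 0, 0, 0, 0, 0, 0, 0, 0, 0, 0;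
    0, 0, 0, 0, 1, 0, 0, 0, 0, 0, 0, 0, 0, 0, 0, 0, 0, 0, 0, 0, 0, 0, 0, 0;
    0, 0, 0, 0, 0, 0, -2, 0, 1, 0, 0, 0, 0, 0, 0, 0, 0, 0, 0, 0, 0, 0, 0, 0;
    0, 0, 0, 0, 0, 0, 0, -2, 0, 1, 0, 0, 0, 0, 0, 0, 0, 0, 0, 0, 0, 0, 0, 0;
    0, 0, 0, 0, 0, 0, 1, 0, -2, 1, 0, 0, 0, 0, 0, 0, 0, 0, 0, 0, 0, 0, 0, 0;
    0, 0, 0, 0, 0, 0, 0, 1, 1, -2, 1, 0, 0, 0, 0, 0, 0, 0, 0, 0, 0, 0, 0, 0;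
    0, 0, 0, 0, 0, 0, 0, 0, 0, 1, -2, 1, 0, 0, 0, 0, 0, 0, 0, 0, 0, 0, 0, 0;
    0, 0, 0, 0, 0, 0, 0, 0, 0, 0, 1, -2, 1, 0, 0, 0, 0, 0, 0, 0, 0, 0, 0, 0;
    0, 0, 0, 0, 0, 0, 0, 0, 0, 0, 0, 1, -2, 1, 0, 0, 0, 0, 0, 0, 0, 0, 0, 0;
    0, 0, 0, 0, 0, 0, 0, 0, 0, 0, 0, 0, 1, -2, 0, 0, 0, 0, 0, 0, 0, 0, 0, 0;
    0, 0, 0, 0, 0, 0, 0, 0, 0, 0, 0, 0, 0, 0, -2, 0, 1, 0, 0, 0, 0, 0, 0, 0;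
    0, 0, 0, 0, 0, 0, 0, 0, 0, 0, 0, 0, 0, 0, 0, -2, 0, 1, 0, 0, 0, 0, 0, 0;
    0, 0, 0, 0, 0, 0, 0, 0, 0, 0, 0, 0, 0, 0, 1, 0, -2, 1, 0, 0, 0, 0, 0, 0;
    0, 0, 0, 0, 0, 0, 0, 0, 0, 0, 0, 0, 0, 0, 0, 1, 1, -2, 1, 0, 0, 0, 0, 0;
    0, 0, 0, 0, 0, 0, 0, 0, 0, 0, 0, 0, 0, 0, 0, 0, 0, 1, -2, 1, 0, 0, 0, 0;
    0, 0, 0, 0, 0, 0, 0, 0, 0, 0, 0, 0, 0, 0, 0, 0, 0, 0, 1, -2, 1, 0, 0, 0;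
    0, 0, 0, 0, 0, 0, 0, 0, 0, 0, 0, 0, 0, 0, 0, 0, 0, 0, 0, 1, -2, 1, 0, 0;
    0, 0, 0, 0, 0, 0, 0, 0, 0, 0, 0, 0, 0, 0, 0, 0, 0, 0, 0, 0, 1, -2, 0, 0;
    0, 0, 0, 0, 0, 0, 0, 0, 0, 0, 0, 0, 0, 0, 0, 0, 0, 0, 0, 0, 0, 0, -2, 1;
    0, 0, 0, 0, 0, 0, 0, 0, 0, 0, 0, 0, 0, 0, 0, 0, 0, 0, 0, 0, 0, 0, 1, -2]

/-- The bilinear form of the lattice `𝐋`. -/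
def Bf (v w : Fin 24 → ℤ) : ℤ := v ⬝ᵥ (LGram *ᵥ w)

/-- An isometry of `𝐋` is a `ℤ`-linear automorphism preserving the bilinear form. -/
def IsIsometry (g : (Fin 24 → ℤ) ≃ₗ[ℤ] (Fin 24 → ℤ)) : Prop :=
  ∀ v w, Bf (g v) (g w) = Bf v w

/-- The invariant sublattice `𝐋^g = {v ∈ 𝐋 : g v = v}`. -/
def invL (g : (Fin 24 → ℤ) ≃ₗ[ℤ] (Fin 24 → ℤ)) : Submodule ℤ (Fin 24 → ℤ) where
  carrier := {v | g v = v}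
  add_mem' := by intro a b ha hb; simp only [Set.mem_setOf_eq, map_add] at *; rw [ha, hb]
  zero_mem' := by simp
  smul_mem' := by intro c a ha; simp only [Set.mem_setOf_eq, _root_.map_smul] at *; rw [ha]

/-- The coinvariant sublattice `𝐋_g = {v ∈ 𝐋 : v·w = 0 for all w ∈ 𝐋^g}`. -/
def coinvL (g : (Fin 24 → ℤ) ≃ₗ[ℤ] (Fin 24 → ℤ)) : Submodule ℤ (Fin 24 → ℤ) where
  carrier := {v | ∀ w ∈ invL g, Bf v w = 0}
  add_mem' := by
    intro a b ha hb w hw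
    simp only [Bf, add_dotProduct] at *
    rw [ha w hw, hb w hw, add_zero]
  zero_mem' := by intro w hw; simp [Bf]
  smul_mem' := by
    intro c a ha w hw
    simp only [Bf, smul_dotProduct] at *
    rw [ha w hw, smul_zero]

/-- The divisibility of `v` in `𝐋` is `d`, i.e. `gcd {v·w : w ∈ 𝐋} = d`. -/
def HasDivisibility (v : Fin 24 → ℤ) (d : ℤ) : Prop :=
  (∀ w, d ∣ Bf v w) ∧ ∀ e : ℤ, (∀ w, e ∣ Bf v w) → e ∣ d

/-- The Gram matrix of `𝐋` over `ℚ`. -/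
def QGram : Matrix (Fin 24) (Fin 24) ℚ := LGram.map (Int.cast)

/-- The bilinear form of `𝐋 ⊗ ℚ`. -/
def Bq (x y : Fin 24 → ℚ) : ℚ := x ⬝ᵥ (QGram *ᵥ y)

/-- The inclusion `𝐋 ⊆ 𝐋 ⊗ ℚ`. -/
def intVec (w : Fin 24 → ℤ) : Fin 24 → ℚ := fun i => (w i : ℚ)

/-- `x ∈ 𝐋 ⊗ ℚ` lies in the dual lattice `𝐋^∨` iff it pairs integrally with `𝐋`. -/
def InDual (x : Fin 24 → ℚ) : Prop := ∀ w : Fin 24 → ℤ, ∃ n : ℤ, Bq x (intVec w) = (n : ℚ)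

/-- `x ∈ 𝐋 ⊗ ℚ` lies in `𝐋` iff all its coordinates are integers. -/
def IsIntVec (x : Fin 24 → ℚ) : Prop := ∀ i, ∃ n : ℤ, x i = (n : ℚ)

/-- The matrix over `ℚ` of the rational extension of `g` to `𝐋 ⊗ ℚ`. -/
def gQ (g : (Fin 24 → ℤ) ≃ₗ[ℤ] (Fin 24 → ℤ)) : Matrix (Fin 24) (Fin 24) ℚ :=
  (LinearMap.toMatrix' g.toLinearMap).map (Int.cast)

/-- `g` acts trivially on the discriminant group `𝐋^♯ = 𝐋^∨/𝐋`, i.e. the induced map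
`g^♯` is the identity: `g(x) - x ∈ 𝐋` for every `x ∈ 𝐋^∨`. -/
def ActsTriviallyOnDisc (g : (Fin 24 → ℤ) ≃ₗ[ℤ] (Fin 24 → ℤ)) : Prop :=
  ∀ x : Fin 24 → ℚ, InDual x → IsIntVec (gQ g *ᵥ x - x)

section analysis
open MeasureTheory Module

lemma pack_sum {E : Type*} [NormedAddCommGroup E] [InnerProductSpace ℝ E] {ι : Type*} [DecidableEq ι]
    (s : Finset ι) (p : ι → E) (h : ∀ i ∈ s, ∀ j ∈ s, i ≠ j → 6 ≤ ‖p i - p j‖ ^ 2) :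
    ∑ i ∈ s, (3 - ‖p i‖ ^ 2) ≤ 3 := by
  have e1 : ∑ i ∈ s, ∑ j ∈ s, ‖p i - p j‖ ^ 2 =
      2 * s.card * ∑ i ∈ s, ‖p i‖ ^ 2 - 2 * ‖∑ i ∈ s, p i‖ ^ 2 := by
    simp_rw [@norm_sub_sq ℝ]
    rw [← real_inner_self_eq_norm_sq (∑ i ∈ s, p i)]
    simp only [Finset.sum_add_distrib, Finset.sum_sub_distrib, sum_inner, inner_sum,
      Finset.sum_const, nsmul_eq_mul, ← Finset.mul_sum, RCLike.re_to_real]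
    rw [Finset.sum_comm (s := s) (t := s) (f := fun x y => inner ℝ (p x) (p y))]
    ring
  have e2 : ∑ i ∈ s, ∑ j ∈ s, (6 - if i = j then (6:ℝ) else 0) ≤ ∑ i ∈ s, ∑ j ∈ s, ‖p i - p j‖ ^ 2 := by
    refine Finset.sum_le_sum fun i hi => Finset.sum_le_sum fun j hj => ?_
    split_ifs with hij
    · subst hij; simp
    · simpa using h i hi j hj hij
  rcases s.eq_empty_or_nonempty with rfl | hs
  · simp
  have hc : (0:ℝ) < s.card := by exact_mod_cast hs.card_pos
  have e3 : ∑ i ∈ s, ∑ j ∈ s, (6 - if i = j then (6:ℝ) else 0) = 6 * s.card * s.card - 6 * s.card := by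
    simp [Finset.sum_sub_distrib]
    ring
  have e4 : ∑ i ∈ s, (3 - ‖p i‖ ^ 2) = 3 * s.card - ∑ i ∈ s, ‖p i‖ ^ 2 := by
    simp [Finset.sum_sub_distrib, mul_comm]
  rw [e4]
  have := sq_nonneg ‖∑ i ∈ s, p i‖
  by_contra hcon
  push Not at hcon
  nlinarith [mul_pos hc (sub_pos.2 hcon)]

lemma blich_lintegral {n : ℕ} (b : Basis (Fin n) ℝ (EuclideanSpace ℝ (Fin n)))
    (hmin : ∀ x ∈ Submodule.span ℤ (Set.range b), x ≠ 0 → 6 ≤ ‖x‖ ^ 2) :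
    ∫⁻ x : EuclideanSpace ℝ (Fin n), ENNReal.ofReal (3 - ‖x‖ ^ 2) ≤
      3 * volume (ZSpan.fundamentalDomain b) := by
  classical
  have hF := ZSpan.isAddFundamentalDomain b (volume : Measure (EuclideanSpace ℝ (Fin n)))
  have hinv : VAddInvariantMeasure (Submodule.span ℤ (Set.range b)) (EuclideanSpace ℝ (Fin n))
      volume := inferInstanceAs <| VAddInvariantMeasure
        (Submodule.span ℤ (Set.range b)).toAddSubgroup (EuclideanSpace ℝ (Fin n)) volume
  rw [hF.lintegral_eq_tsum'', ← lintegral_tsum, ← setLIntegral_const]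
  · refine lintegral_mono fun x => ?_
    rw [ENNReal.tsum_eq_iSup_sum]
    refine iSup_le fun s => ?_
    have hs : ∑ g ∈ s, ENNReal.ofReal (3 - ‖g +ᵥ x‖ ^ 2) =
        ∑ g ∈ s with (0:ℝ) ≤ (3:ℝ) - ‖g +ᵥ x‖ ^ 2, ENNReal.ofReal (3 - ‖g +ᵥ x‖ ^ 2) := by
      rw [Finset.sum_filter_of_ne]
      intro g _ hg
      by_contra hc
      exact hg (ENNReal.ofReal_of_nonpos (by linarith))
    rw [hs, ← ENNReal.ofReal_sum_of_nonneg]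
    · rw [show (3 : ENNReal) = ENNReal.ofReal 3 by simp]
      apply ENNReal.ofReal_le_ofReal
      apply pack_sum
      intro i _ j _ hij
      have : (i +ᵥ x) - (j +ᵥ x) = ((i - j : Submodule.span ℤ (Set.range b)) : EuclideanSpace ℝ (Fin n)) := by
        simp [Submodule.vadd_def]
      rw [this]
      apply hmin _ (Subtype.mem _)
      simpa [sub_eq_zero] using hij
    · intro i hi
      exact (Finset.mem_filter.1 hi).2
  · intro g
    have : Measurable fun x : EuclideanSpace ℝ (Fin n) => ENNReal.ofReal (3 - ‖g +ᵥ x‖ ^ 2) := by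
      simp only [Submodule.vadd_def, vadd_eq_add]
      fun_prop
    exact this.aemeasurable

lemma vol_fd {n : ℕ} (b : Basis (Fin n) ℝ (EuclideanSpace ℝ (Fin n))) :
    volume (ZSpan.fundamentalDomain b) =
      ENNReal.ofReal |(EuclideanSpace.basisFun (Fin n) ℝ).toBasis.det b| := by
  rw [ZSpan.measure_fundamentalDomain b volume (EuclideanSpace.basisFun (Fin n) ℝ).toBasis]
  rw [measure_congr (ZSpan.fundamentalDomain_ae_parallelepiped _ volume)]
  have := (EuclideanSpace.basisFun (Fin n) ℝ).volume_parallelepiped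
  simp only [OrthonormalBasis.coe_toBasis] 
  rw [this, mul_one]

lemma int_one_dim (n : ℕ) (hn : 0 < n) :
    ∫ y in Set.Ioi (0:ℝ), y ^ (n - 1) • max (3 - y ^ 2) 0 = √3 ^ n * 3 * 2 / (n * (n + 2)) := by
  have h1 : ∫ y in Set.Ioi (0:ℝ), y ^ (n - 1) • max (3 - y ^ 2) 0 =
      ∫ y in Set.Ioc (0:ℝ) √3, y ^ (n - 1) • (3 - y ^ 2) := by
    rw [← integral_indicator measurableSet_Ioi, ← integral_indicator measurableSet_Ioc]
    congr 1
    ext y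
    simp only [Set.indicator, Set.mem_Ioi, Set.mem_Ioc]
    by_cases hy : 0 < y
    · by_cases hy2 : y ≤ √3
      · have : y ^ 2 ≤ 3 := by
          have := Real.sq_sqrt (show (0:ℝ) ≤ 3 by norm_num)
          nlinarith
        simp [hy, hy2, this]
      · have : 3 ≤ y ^ 2 := by
          have := Real.sq_sqrt (show (0:ℝ) ≤ 3 by norm_num)
          have := Real.sqrt_nonneg 3
          nlinarith
        simp [hy2, hy, this]
    · simp [hy]
  rw [h1, ← intervalIntegral.integral_of_le (Real.sqrt_nonneg 3)]
  obtain ⟨m, rfl⟩ : ∃ m, n = m + 1 := ⟨n - 1, by omega⟩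
  have h2 : ∀ y : ℝ, y ^ (m + 1 - 1) • (3 - y ^ 2) = 3 * y ^ m - y ^ (m + 2) := by
    intro y; simp; ring
  simp_rw [h2]
  rw [intervalIntegral.integral_sub (by apply Continuous.intervalIntegrable; fun_prop) (by apply Continuous.intervalIntegrable; fun_prop),
    intervalIntegral.integral_const_mul, integral_pow, integral_pow]
  have h3 : √3 ^ (m + 2 + 1) = √3 ^ (m + 1) * 3 := by
    rw [show m + 2 + 1 = (m + 1) + 2 by ring, pow_add, Real.sq_sqrt (by norm_num)]
  rw [h3]
  push_cast
  field_simp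
  simp
  ring

lemma int_val (n : ℕ) (hn : 0 < n) :
    ∫⁻ x : EuclideanSpace ℝ (Fin n), ENNReal.ofReal (3 - ‖x‖ ^ 2) =
      ENNReal.ofReal (√Real.pi ^ n / Real.Gamma (n / 2 + 1) * (√3 ^ n * 3 * 2 / (n + 2))) := by
  have : Nonempty (Fin n) := ⟨⟨0, hn⟩⟩
  have : Nontrivial (EuclideanSpace ℝ (Fin n)) := by
    apply Module.nontrivial_of_finrank_pos (R := ℝ); simpa using hn
  have h0 : ∀ x : EuclideanSpace ℝ (Fin n), ENNReal.ofReal (3 - ‖x‖ ^ 2) = ENNReal.ofReal (max (3 - ‖x‖ ^ 2) 0) := by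
    intro x; simp
  simp_rw [h0]
  have hint : Integrable (fun x : EuclideanSpace ℝ (Fin n) => max (3 - ‖x‖ ^ 2) 0) := by
    apply Continuous.integrable_of_hasCompactSupport (by fun_prop)
    apply HasCompactSupport.of_support_subset_isCompact (isCompact_closedBall 0 √3)
    intro x hx
    simp only [Function.mem_support, ne_eq, sup_eq_right, not_le] at hx
    simp only [Metric.mem_closedBall, dist_zero_right]
    apply Real.le_sqrt_of_sq_le
    linarith
  rw [← ofReal_integral_eq_lintegral_ofReal hint (Filter.Eventually.of_forall fun x => by simp)]
  rw [integral_fun_norm_addHaar volume (fun y : ℝ => max (3 - y ^ 2) 0)]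
  rw [finrank_euclideanSpace, Fintype.card_fin, int_one_dim n hn]
  congr 1
  have hG : 0 < Real.Gamma ((n:ℝ) / 2 + 1) := Real.Gamma_pos_of_pos (by positivity)
  rw [measureReal_def, EuclideanSpace.volume_ball]
  simp only [Fintype.card_fin, ENNReal.ofReal_one, one_pow, one_mul]
  rw [ENNReal.toReal_ofReal (by positivity)]
  simp only [smul_eq_mul, nsmul_eq_mul]
  have : (n:ℝ) ≠ 0 := by positivity
  field_simp

lemma blich {n : ℕ} (hn : 0 < n) (b : Basis (Fin n) ℝ (EuclideanSpace ℝ (Fin n)))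
    (hmin : ∀ x ∈ Submodule.span ℤ (Set.range b), x ≠ 0 → 6 ≤ ‖x‖ ^ 2) :
    (3 * Real.pi) ^ n / Real.Gamma (n / 2 + 2) ^ 2 ≤
      (EuclideanSpace.basisFun (Fin n) ℝ).toBasis.det b ^ 2 := by
  have h := blich_lintegral b hmin
  rw [int_val n hn, vol_fd, show (3 : ENNReal) = ENNReal.ofReal 3 by simp,
    ← ENNReal.ofReal_mul (by norm_num), ENNReal.ofReal_le_ofReal_iff (by positivity)] at h
  have hG : 0 < Real.Gamma ((n:ℝ) / 2 + 1) := Real.Gamma_pos_of_pos (by positivity)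
  have hG2 : Real.Gamma ((n:ℝ) / 2 + 2) = ((n:ℝ) / 2 + 1) * Real.Gamma ((n:ℝ) / 2 + 1) := by
    rw [← Real.Gamma_add_one (by positivity)]; ring_nf
  have h5 : √Real.pi ^ n * √3 ^ n / Real.Gamma (n / 2 + 2) ≤ 
      |(EuclideanSpace.basisFun (Fin n) ℝ).toBasis.det b| := by
    have : √Real.pi ^ n / Real.Gamma (n / 2 + 1) * (√3 ^ n * 3 * 2 / (n + 2)) = 
      3 * (√Real.pi ^ n * √3 ^ n / Real.Gamma (n / 2 + 2)) := by
      rw [hG2]; field_simp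
    linarith
  have hG3 : 0 < Real.Gamma ((n:ℝ) / 2 + 2) := Real.Gamma_pos_of_pos (by positivity)
  have h6 := pow_le_pow_left₀ (by positivity) h5 2
  rw [sq_abs] at h6
  refine le_of_eq_of_le ?_ h6
  rw [div_pow, mul_pow (√Real.pi ^ n), ← pow_mul, ← pow_mul, mul_comm n 2, pow_mul, pow_mul, Real.sq_sqrt Real.pi_pos.le,
    Real.sq_sqrt (by norm_num), ← mul_pow, mul_comm Real.pi]

open Matrix in
lemma gram_psd {n : ℕ} (G : Matrix (Fin n) (Fin n) ℤ) (hs : G.IsSymm)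
    (hmin : ∀ x : Fin n → ℤ, x ≠ 0 → 6 ≤ x ⬝ᵥ (G *ᵥ x)) :
    (G.map (Int.cast : ℤ → ℝ)).PosSemidef := by
  have hint : ∀ x : Fin n → ℤ, 0 ≤ x ⬝ᵥ (G *ᵥ x) := by
    intro x
    by_cases hx : x = 0
    · simp [hx]
    · linarith [hmin x hx]
  have hq : ∀ x : Fin n → ℚ, 0 ≤ (fun i => (x i : ℝ)) ⬝ᵥ (G.map (Int.cast : ℤ → ℝ) *ᵥ (fun i => (x i : ℝ))) := by
    intro x
    obtain ⟨⟨d, hd⟩, hd2⟩ := IsLocalization.exist_integer_multiples_of_finite (nonZeroDivisors ℤ) x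
    choose y hy using hd2
    have hd0 : (d:ℝ) ≠ 0 := by exact_mod_cast nonZeroDivisors.ne_zero hd
    have hy' : ∀ i, (y i : ℝ) = d * x i := by
      intro i
      have := hy i
      simp at this
      exact_mod_cast this
    have h1 := hint y
    have h2 : ((y ⬝ᵥ (G *ᵥ y) : ℤ) : ℝ) = d ^ 2 * ((fun i => (x i : ℝ)) ⬝ᵥ (G.map (Int.cast : ℤ → ℝ) *ᵥ (fun i => (x i : ℝ)))) := by
      simp only [dotProduct, mulVec, Matrix.map_apply, Finset.mul_sum]
      push_cast
      refine Finset.sum_congr rfl fun i _ => Finset.sum_congr rfl fun j _ => ?_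
      rw [hy', hy']; ring
    have h3 : (0:ℝ) ≤ ((y ⬝ᵥ (G *ᵥ y) : ℤ) : ℝ) := by exact_mod_cast h1
    rw [h2] at h3
    exact nonneg_of_mul_nonneg_right h3 (by positivity)
  refine Matrix.PosSemidef.of_dotProduct_mulVec_nonneg ?_ ?_
  · ext i j
    simp [Matrix.conjTranspose_apply, hs.apply]
  · intro x
    have hd : DenseRange (fun (x : Fin n → ℚ) (i : Fin n) => (x i : ℝ)) :=
      DenseRange.piMap (f := fun (_ : Fin n) (q : ℚ) => (q : ℝ)) fun _ => Rat.denseRange_cast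
    simp only [star_trivial]
    refine hd.induction_on (p := fun x => 0 ≤ x ⬝ᵥ (G.map (Int.cast : ℤ → ℝ) *ᵥ x)) x ?_ hq
    apply isClosed_le continuous_const
    simp only [dotProduct, mulVec]
    fun_prop

open Matrix MatrixOrder Matrix.Norms.L2Operator in
theorem gram_bound {n : ℕ} (hn : 0 < n) (G : Matrix (Fin n) (Fin n) ℤ) (hs : G.IsSymm)
    (hmin : ∀ x : Fin n → ℤ, x ≠ 0 → 6 ≤ x ⬝ᵥ (G *ᵥ x)) :
    (3 * Real.pi) ^ n / Real.Gamma (n / 2 + 2) ^ 2 ≤ (G.det : ℝ) := by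
  have hdet : G.det ≠ 0 := by
    intro h
    obtain ⟨v, hv, hv2⟩ := Matrix.exists_mulVec_eq_zero_iff.2 h
    have := hmin v hv
    rw [hv2] at this
    simp at this
  obtain ⟨B, hB⟩ := CStarAlgebra.nonneg_iff_eq_star_mul_self.1 (gram_psd G hs hmin).nonneg
  have hBd : (G.det : ℝ) = B.det ^ 2 := by
    have := congrArg Matrix.det hB
    rw [Matrix.det_mul] at this
    have e : (G.map (Int.cast : ℤ → ℝ)).det = (G.det : ℝ) := by
      simpa using (RingHom.map_det (Int.castRingHom ℝ) G).symm
    rw [← e, this, Matrix.star_eq_conjTranspose, Matrix.det_conjTranspose]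
    simp [sq]
  have hBu : IsUnit B.det := by
    rw [isUnit_iff_ne_zero]
    intro h
    rw [h] at hBd
    exact hdet (by exact_mod_cast (by simpa using hBd))
  let e0 := (EuclideanSpace.basisFun (Fin n) ℝ).toBasis
  let b : Basis (Fin n) ℝ (EuclideanSpace ℝ (Fin n)) :=
    e0.map ((Matrix.toLinearEquiv e0 B hBu))
  have hb : ∀ j, b j = WithLp.toLp 2 (fun i => B i j) := by
    intro j
    ext i
    have : b j = Matrix.toLin e0 e0 B (e0 j) := rfl
    rw [this, Matrix.toLin_self]
    simp [e0, Pi.single_apply]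
  have hbd : e0.det b = B.det := by
    rw [Basis.det_apply]
    congr 1
    ext i j
    rw [Basis.toMatrix_apply, hb]
    simp [e0]
  rw [hBd, ← hbd]
  apply blich hn
  intro x hx hx0
  obtain ⟨c, rfl⟩ := (Submodule.mem_span_range_iff_exists_fun ℤ).1 hx
  have hc : c ≠ 0 := by
    rintro rfl
    simp at hx0
  have := hmin c hc
  have e : ‖∑ i, c i • b i‖ ^ 2 = ((c ⬝ᵥ (G *ᵥ c) : ℤ) : ℝ) := by
    have hin : ∀ i j, inner ℝ (b i) (b j) = (G i j : ℝ) := by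
      intro i j
      have := congrFun (congrFun hB i) j
      simp only [Matrix.map_apply] at this
      rw [this, hb, hb]
      simp [Matrix.mul_apply, PiLp.inner_apply, mul_comm]
    rw [← real_inner_self_eq_norm_sq]
    simp only [dotProduct, mulVec, Finset.mul_sum]
    simp only [← Int.cast_smul_eq_zsmul ℝ, sum_inner, inner_sum, real_inner_smul_left, real_inner_smul_right, hin]
    push_cast
    rw [Finset.sum_comm]
    refine Finset.sum_congr rfl fun i _ => Finset.sum_congr rfl fun j _ => ?_
    rw [← hs.apply]
    ring
  rw [e]
  exact_mod_cast this

lemma numeric (n : ℕ) (h2 : 2 ≤ n) (h24 : n ≤ 24) :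
    (3 * 2 ^ min n (24 - n) : ℝ) < (3 * Real.pi) ^ n / Real.Gamma (n / 2 + 2) ^ 2 := by
  have hpi : 9.42 < 3 * Real.pi := by linarith [Real.pi_gt_d2]
  have hG : 0 < Real.Gamma ((n:ℝ) / 2 + 2) := Real.Gamma_pos_of_pos (by positivity)
  rw [lt_div_iff₀ (by positivity)]
  obtain ⟨k, hk | hk⟩ := n.even_or_odd'
  · have : Real.Gamma ((n:ℝ) / 2 + 2) = (k + 1).factorial := by
      rw [hk, ← Real.Gamma_nat_eq_factorial]; push_cast; congr 1; ring
    rw [this]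
    refine lt_of_lt_of_le ?_ (pow_le_pow_left₀ (by norm_num) hpi.le n)
    subst hk
    have : k ≤ 12 := by omega
    have h1k : 1 ≤ k := by omega
    clear * - this h1k
    interval_cases k <;> norm_num [Nat.factorial]
  · have e : Real.Gamma ((n:ℝ) / 2 + 2) = (2 * k + 3 : ℕ).doubleFactorial * √Real.pi / 2 ^ (k + 2) := by
      have := Real.Gamma_nat_add_half (k + 2)
      rw [hk]
      rw [show 2 * (k + 2) - 1 = 2 * k + 3 by omega] at this
      rw [← this]
      congr 1
      push_cast; ring
      
    have e2 : Real.Gamma ((n:ℝ) / 2 + 2) ^ 2 = ((2 * k + 3 : ℕ).doubleFactorial / 2 ^ (k + 2)) ^ 2 / 3 * (3 * Real.pi) := by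
      rw [e, div_pow, mul_pow, Real.sq_sqrt Real.pi_pos.le]; field_simp
    have e3 : (3 * Real.pi) ^ n = (3 * Real.pi) ^ (2 * k) * (3 * Real.pi) := by rw [hk, pow_succ]
    rw [e2, e3, ← mul_assoc]
    refine mul_lt_mul_of_pos_right ?_ (by positivity)
    refine lt_of_lt_of_le ?_ (pow_le_pow_left₀ (by norm_num) hpi.le (2 * k))
    subst hk
    have : k ≤ 11 := by omega
    have h1k : 1 ≤ k := by omega
    clear * - this h1k
    interval_cases k <;> norm_num [Nat.doubleFactorial]

end analysis
section algebra
open Module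
/-- An integral matrix with `LGram * LInv` lower triangular of determinant `3`. -/
def LInv : Matrix (Fin 24) (Fin 24) ℤ :=
  !![0, 1, 0, 0, 0, 0, 0, 0, 0, 0, 0, 0, 0, 0, 0, 0, 0, 0, 0, 0, 0, 0, 0, 0;
    1, 0, 0, 0, 0, 0, 0, 0, 0, 0, 0, 0, 0, 0, 0, 0, 0, 0, 0, 0, 0, 0, 0, 0;
    0, 0, 0, 1, 0, 0, 0, 0, 0, 0, 0, 0, 0, 0, 0, 0, 0, 0, 0, 0, 0, 0, 0, 0;
    0, 0, 1, 0, 0, 0, 0, 0, 0, 0, 0, 0, 0, 0, 0, 0, 0, 0, 0, 0, 0, 0, 0, 0;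
    0, 0, 0, 0, 0, 1, 0, 0, 0, 0, 0, 0, 0, 0, 0, 0, 0, 0, 0, 0, 0, 0, 0, 0;
    0, 0, 0, 0, 1, 0, 0, 0, 0, 0, 0, 0, 0, 0, 0, 0, 0, 0, 0, 0, 0, 0, 0, 0;
    0, 0, 0, 0, 0, 0, -4, -5, -7, -10, -8, -6, -4, -2, 0, 0, 0, 0, 0, 0, 0, 0, 0, 0;
    0, 0, 0, 0, 0, 0, -5, -8, -10, -15, -12, -9, -6, -3, 0, 0, 0, 0, 0, 0, 0, 0, 0, 0;
    0, 0, 0, 0, 0, 0, -7, -10, -14, -20, -16, -12, -8, -4, 0, 0, 0, 0, 0, 0, 0, 0, 0, 0;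
    0, 0, 0, 0, 0, 0, -10, -15, -20, -30, -24, -18, -12, -6, 0, 0, 0, 0, 0, 0, 0, 0, 0, 0;
    0, 0, 0, 0, 0, 0, -8, -12, -16, -24, -20, -15, -10, -5, 0, 0, 0, 0, 0, 0, 0, 0, 0, 0;
    0, 0, 0, 0, 0, 0, -6, -9, -12, -18, -15, -12, -8, -4, 0, 0, 0, 0, 0, 0, 0, 0, 0, 0;
    0, 0, 0, 0, 0, 0, -4, -6, -8, -12, -10, -8, -6, -3, 0, 0, 0, 0, 0, 0, 0, 0, 0, 0;
    0, 0, 0, 0, 0, 0, -2, -3, -4, -6, -5, -4, -3, -2, 0, 0, 0, 0, 0, 0, 0, 0, 0, 0;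
    0, 0, 0, 0, 0, 0, 0, 0, 0, 0, 0, 0, 0, 0, -4, -5, -7, -10, -8, -6, -4, -2, 0, 0;
    0, 0, 0, 0, 0, 0, 0, 0, 0, 0, 0, 0, 0, 0, -5, -8, -10, -15, -12, -9, -6, -3, 0, 0;
    0, 0, 0, 0, 0, 0, 0, 0, 0, 0, 0, 0, 0, 0, -7, -10, -14, -20, -16, -12, -8, -4, 0, 0;
    0, 0, 0, 0, 0, 0, 0, 0, 0, 0, 0, 0, 0, 0, -10, -15, -20, -30, -24, -18, -12, -6, 0, 0;
    0, 0, 0, 0, 0, 0, 0, 0, 0, 0, 0, 0, 0, 0, -8, -12, -16, -24, -20, -15, -10, -5, 0, 0;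
    0, 0, 0, 0, 0, 0, 0, 0, 0, 0, 0, 0, 0, 0, -6, -9, -12, -18, -15, -12, -8, -4, 0, 0;
    0, 0, 0, 0, 0, 0, 0, 0, 0, 0, 0, 0, 0, 0, -4, -6, -8, -12, -10, -8, -6, -3, 0, 0;
    0, 0, 0, 0, 0, 0, 0, 0, 0, 0, 0, 0, 0, 0, -2, -3, -4, -6, -5, -4, -3, -2, 0, 0;
    0, 0, 0, 0, 0, 0, 0, 0, 0, 0, 0, 0, 0, 0, 0, 0, 0, 0, 0, 0, 0, 0, 0, -1;
    0, 0, 0, 0, 0, 0, 0, 0, 0, 0, 0, 0, 0, 0, 0, 0, 0, 0, 0, 0, 0, 0, 1, -2]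

/-- The lower triangular matrix `LGram * LInv`. -/
def LTri : Matrix (Fin 24) (Fin 24) ℤ := fun i j =>
  if i = j then (if i = 23 then 3 else 1) else if i = 23 ∧ j = 22 then -2 else 0

set_option maxRecDepth 100000 in
lemma LGram_mul_LInv : LGram * LInv = LTri := by
  decide +kernel

lemma LTri_det : LTri.det = 3 := by
  rw [Matrix.det_of_lowerTriangular]
  · decide +kernel
  · intro i j hij
    have hij' : i < j := hij
    simp only [LTri]
    rw [if_neg hij'.ne, if_neg]
    rintro ⟨rfl, rfl⟩
    exact absurd hij' (by decide)

lemma LGram_det_dvd : LGram.det ∣ 3 :=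
  ⟨LInv.det, by rw [← Matrix.det_mul, LGram_mul_LInv, LTri_det]⟩

lemma LGram_symm : LGram.IsSymm := by
  unfold Matrix.IsSymm
  decide +kernel

/-- Half of the Gram matrix, exhibiting evenness. -/
def LHalf : Matrix (Fin 24) (Fin 24) ℤ := fun i j =>
  if i < j then LGram i j else if i = j then LGram i i / 2 else 0

lemma LGram_half : LGram = LHalf + LHalfᵀ := by
  decide +kernel

lemma Bf_comm (v w : Fin 24 → ℤ) : Bf v w = Bf w v := by
  unfold Bf
  rw [dotProduct_mulVec, ← mulVec_transpose, LGram_symm.eq, dotProduct_comm]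

lemma Bf_even (v : Fin 24 → ℤ) : ∃ k, Bf v v = 2 * k := by
  refine ⟨v ⬝ᵥ (LHalf *ᵥ v), ?_⟩
  unfold Bf
  rw [LGram_half, add_mulVec, dotProduct_add, two_mul]
  congr 1
  rw [mulVec_transpose, dotProduct_comm, dotProduct_mulVec]

/-- The form as a bilinear map. -/
def BfL : (Fin 24 → ℤ) →ₗ[ℤ] (Fin 24 → ℤ) →ₗ[ℤ] ℤ := Matrix.toLinearMap₂' ℤ LGram

lemma BfL_apply (v w : Fin 24 → ℤ) : BfL v w = Bf v w := by
  simp [BfL, Bf, Matrix.toLinearMap₂'_apply']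

lemma index_range_mulVec {ι : Type*} [Fintype ι] [DecidableEq ι] (M : Matrix ι ι ℤ) (h : M.det ≠ 0) :
    (M.mulVecLin.range).toAddSubgroup.index = M.det.natAbs := by
  have hinj : Function.Injective M.mulVecLin := Matrix.mulVec_injective_of_det_ne_zero h
  let e := LinearEquiv.ofInjective M.mulVecLin hinj
  let bN := (Pi.basisFun ℤ ι).map e
  rw [AddSubgroup.index_eq_natAbs_det (Pi.basisFun ℤ ι) _ bN]
  congr 1
  rw [Basis.det_apply]
  congr 1
  ext i j
  simp [Basis.toMatrix_apply, bN, e]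

lemma index_le_two_pow {M : Type*} [AddCommGroup M] [Module.Finite ℤ M] (N J : Submodule ℤ M)
    (hNJ : N ≤ J) (k : ℕ) [Module.Free ℤ (M ⧸ N)] (hk : Module.finrank ℤ (M ⧸ N) ≤ k)
    (h2 : ∀ x : M, (2 : ℤ) • x ∈ J) : J.toAddSubgroup.index ≤ 2 ^ k := by
  let b := Module.finBasis ℤ (M ⧸ N)
  let f : (M ⧸ N) →ₗ[ℤ] (M ⧸ J) := Submodule.factor hNJ
  let s : (Fin (Module.finrank ℤ (M ⧸ N)) → Fin 2) → M ⧸ J := fun c => f (∑ i, ((c i : ℕ) : ℤ) • b i)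
  have hs : Function.Surjective s := by
    intro q
    obtain ⟨y, rfl⟩ := Submodule.factor_surjective hNJ q
    have h2q : ∀ y : M ⧸ N, f ((2 : ℤ) • y) = 0 := by
      intro y
      obtain ⟨x, rfl⟩ := Submodule.Quotient.mk_surjective N y
      change Submodule.Quotient.mk ((2 : ℤ) • x) = (0 : M ⧸ J)
      rw [Submodule.Quotient.mk_eq_zero]
      exact h2 x
    refine ⟨fun i => ⟨((b.repr y i) % 2).toNat, by omega⟩, ?_⟩
    change f _ = f y
    rw [← sub_eq_zero, ← map_sub]
    have : (∑ i, (((⟨((b.repr y i) % 2).toNat, by omega⟩ : Fin 2) : ℕ) : ℤ) • b i) - y =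
        (2 : ℤ) • (-∑ i, (b.repr y i / 2) • b i) := by
      conv_lhs => rw [← b.sum_repr y]
      rw [← Finset.sum_sub_distrib, ← Finset.sum_neg_distrib, Finset.smul_sum]
      refine Finset.sum_congr rfl fun i _ => ?_
      rw [← sub_smul, ← neg_smul, smul_smul]
      congr 1
      simp only [Basis.repr_sum_self]
      have := Int.toNat_of_nonneg (Int.emod_nonneg (b.repr y i) (show (2:ℤ) ≠ 0 by norm_num))
      omega
    rw [this, h2q]
  have h := Nat.card_le_card_of_surjective s hs
  simp only [Nat.card_eq_fintype_card, Fintype.card_fun, Fintype.card_fin] at h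
  refine le_trans (le_of_eq_of_le ?_ h) (Nat.pow_le_pow_right (by norm_num) hk)
  rfl

end algebra

section main
open Module
variable (g : (Fin 24 → ℤ) ≃ₗ[ℤ] (Fin 24 → ℤ))

lemma sub_mem_coinvL (hiso : IsIsometry g) (x : Fin 24 → ℤ) : x - g x ∈ coinvL g := by
  intro w hw
  have hw' : g w = w := hw
  have h := hiso x w
  rw [hw'] at h
  rw [← BfL_apply] at h ⊢
  rw [map_sub, LinearMap.sub_apply, h, BfL_apply, sub_self]

lemma add_mem_invL (hg : ∀ x, g (g x) = x) (x : Fin 24 → ℤ) : x + g x ∈ invL g := by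
  change g (x + g x) = x + g x
  rw [map_add, hg, add_comm]

lemma coinvL_saturated (n : ℤ) (hn : n ≠ 0) (x : Fin 24 → ℤ) (h : n • x ∈ coinvL g) :
    x ∈ coinvL g := by
  intro w hw
  have := h w hw
  rw [← BfL_apply, map_smul, LinearMap.smul_apply, BfL_apply, smul_eq_mul] at this
  exact (mul_eq_zero.1 this).resolve_left hn

lemma coinvL_quot_free : Module.Free ℤ ((Fin 24 → ℤ) ⧸ coinvL g) := by
  have : Module.IsTorsionFree ℤ ((Fin 24 → ℤ) ⧸ coinvL g) := by
    rw [Module.isTorsionFree_iff_smul_eq_zero]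
    intro n q h
    obtain ⟨x, rfl⟩ := Submodule.Quotient.mk_surjective _ q
    by_cases hn : n = 0
    · exact Or.inl hn
    · right
      rw [← Submodule.Quotient.mk_smul, Submodule.Quotient.mk_eq_zero] at h
      rw [Submodule.Quotient.mk_eq_zero]
      exact coinvL_saturated g n hn x h
  infer_instance

lemma coinvL_finrank_quot :
    Module.finrank ℤ ((Fin 24 → ℤ) ⧸ coinvL g) + Module.finrank ℤ (coinvL g) = 24 := by
  have := Submodule.finrank_quotient_add_finrank (coinvL g)
  simpa using this

/-- Negated Gram matrix of the coinvariant lattice. -/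
noncomputable def coG {r : ℕ} (b : Basis (Fin r) ℤ (coinvL g)) : Matrix (Fin r) (Fin r) ℤ :=
  fun i j => - Bf (b i) (b j)

lemma coG_symm {r : ℕ} (b : Basis (Fin r) ℤ (coinvL g)) : (coG g b).IsSymm := by
  ext i j
  simp [coG, Bf_comm (b i)]

lemma coG_form {r : ℕ} (b : Basis (Fin r) ℤ (coinvL g)) (x : Fin r → ℤ) :
    x ⬝ᵥ (coG g b *ᵥ x) = - Bf (∑ i, x i • b i : coinvL g) (∑ i, x i • b i : coinvL g) := by
  rw [← BfL_apply]
  push_cast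
  simp only [map_sum, map_smul, LinearMap.sum_apply, LinearMap.smul_apply, BfL_apply, coG,
    dotProduct, mulVec, smul_eq_mul, ← Finset.sum_neg_distrib, Finset.mul_sum]
  rw [Finset.sum_comm]
  refine Finset.sum_congr rfl fun i _ => Finset.sum_congr rfl fun j _ => ?_
  rw [Bf_comm]
  ring

/-- Restriction of the dot product to the coinvariant lattice. -/
noncomputable def resL {r : ℕ} (b : Basis (Fin r) ℤ (coinvL g)) :
    (Fin 24 → ℤ) →ₗ[ℤ] (Fin r → ℤ) :=
  Matrix.mulVecLin (Matrix.of fun i j => (b i : Fin 24 → ℤ) j)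

lemma resL_surj {r : ℕ} (b : Basis (Fin r) ℤ (coinvL g)) : Function.Surjective (resL g b) := by
  have := coinvL_quot_free g
  obtain ⟨s, hs⟩ := Module.projective_lifting_property (coinvL g).mkQ LinearMap.id
    (coinvL g).mkQ_surjective
  have hs' : ∀ q, (coinvL g).mkQ (s q) = q := fun q => LinearMap.congr_fun hs q
  let ρ : (Fin 24 → ℤ) →ₗ[ℤ] coinvL g :=
    LinearMap.codRestrict (coinvL g) (LinearMap.id - s ∘ₗ (coinvL g).mkQ) (by
      intro x
      rw [← Submodule.Quotient.mk_eq_zero, ← Submodule.mkQ_apply]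
      simp only [LinearMap.sub_apply, LinearMap.id_apply, LinearMap.comp_apply, map_sub, hs',
        sub_self])
  have hρ : ∀ c : coinvL g, ρ c = c := by
    intro c
    ext1
    have : (coinvL g).mkQ (c : Fin 24 → ℤ) = 0 := by simp
    change (c : Fin 24 → ℤ) - s ((coinvL g).mkQ (c : Fin 24 → ℤ)) = c
    rw [this, map_zero, sub_zero]
  intro t
  let f : (Fin 24 → ℤ) →ₗ[ℤ] ℤ := (∑ i, t i • b.coord i) ∘ₗ ρ
  have hf : ∀ i, f (b i) = t i := by
    intro i
    simp [f, hρ, Finsupp.single_apply]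
  refine ⟨fun j => f (Pi.single j 1), ?_⟩
  ext i
  rw [← hf i, LinearMap.pi_apply_eq_sum_univ f (b i)]
  simp only [resL, mulVecLin_apply, mulVec, dotProduct, of_apply, smul_eq_mul]
  refine Finset.sum_congr rfl fun j _ => ?_
  congr 2
  ext k
  simp [Pi.single_apply, eq_comm]

lemma coG_det_le (hiso : IsIsometry g) (hg : ∀ x, g (g x) = x) {r : ℕ}
    (b : Basis (Fin r) ℤ (coinvL g)) (hdet : (coG g b).det ≠ 0) :
    (coG g b).det.natAbs ≤ 3 * 2 ^ min r (24 - r) := by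
  have hfree := coinvL_quot_free g
  have hr : Module.finrank ℤ (coinvL g) = r := by
    rw [Module.finrank_eq_card_basis b, Fintype.card_fin]
  have hrq := coinvL_finrank_quot g
  let S := LGram.mulVecLin
  let φ := resL g b ∘ₗ S
  have hφ : ∀ x i, φ x i = Bf (b i) x := by
    intro x i
    simp [φ, S, resL, Bf, mulVec, dotProduct]
  -- the image of the coinvariant lattice
  have himg : (coinvL g).map φ = (coG g b).mulVecLin.range := by
    apply le_antisymm
    · rintro _ ⟨x, hx, rfl⟩
      refine ⟨fun i => - b.repr ⟨x, hx⟩ i, ?_⟩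
      have e := b.sum_repr ⟨x, hx⟩
      have e' : x = ∑ i, b.repr ⟨x, hx⟩ i • (b i : Fin 24 → ℤ) := by
        have := congrArg Subtype.val e
        push_cast at this
        exact this.symm
      ext i
      rw [hφ]
      conv_rhs => rw [e', ← BfL_apply, map_sum]
      simp only [map_smul, BfL_apply, coG, mulVecLin_apply, mulVec, dotProduct, smul_eq_mul]
      exact Finset.sum_congr rfl fun j _ => by ring
    · rintro _ ⟨c, rfl⟩
      refine ⟨((-∑ i, c i • b i : coinvL g) : Fin 24 → ℤ), Subtype.mem _, ?_⟩
      ext i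
      rw [hφ, ← BfL_apply]
      push_cast
      simp only [map_neg, map_sum, map_smul, BfL_apply, coG, mulVecLin_apply, mulVec, dotProduct,
        smul_eq_mul, ← Finset.sum_neg_distrib]
      exact Finset.sum_congr rfl fun j _ => by ring
  have h1 := index_range_mulVec _ hdet
  rw [← himg] at h1
  have h2 : ((coinvL g).map φ).toAddSubgroup =
      (coinvL g).toAddSubgroup.map φ.toAddMonoidHom := rfl
  rw [h2, AddSubgroup.index_map] at h1
  rw [← h1]
  -- index of the image of the whole lattice
  have hS : (LGram.mulVecLin.range).toAddSubgroup.index ∣ 3 := by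
    rw [index_range_mulVec]
    · have := Int.natAbs_dvd_natAbs.2 LGram_det_dvd
      simpa using this
    · intro h
      have := LGram_det_dvd
      rw [h] at this
      norm_num at this
  have h3 : φ.toAddMonoidHom.range.index ≤ 3 := by
    have e : φ.toAddMonoidHom.range = (LGram.mulVecLin.range).toAddSubgroup.map (resL g b).toAddMonoidHom := by
      ext y
      constructor
      · rintro ⟨x, rfl⟩
        exact ⟨S x, ⟨x, rfl⟩, rfl⟩
      · rintro ⟨_, ⟨x, rfl⟩, rfl⟩
        exact ⟨x, rfl⟩
    rw [e]
    refine Nat.le_of_dvd (by norm_num) (dvd_trans (AddSubgroup.index_map_dvd _ ?_) hS)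
    exact resL_surj g b
  have hJ : (coinvL g).toAddSubgroup ⊔ φ.toAddMonoidHom.ker = (coinvL g ⊔ φ.ker).toAddSubgroup := by
    rw [Submodule.sup_toAddSubgroup]
    rfl
  have htwo : ∀ x : Fin 24 → ℤ, (2 : ℤ) • x ∈ coinvL g ⊔ φ.ker := by
    intro x
    have : (2 : ℤ) • x = (x - g x) + (x + g x) := by rw [two_smul]; abel
    rw [this]
    refine Submodule.add_mem_sup (sub_mem_coinvL g hiso x) ?_
    rw [LinearMap.mem_ker]
    ext i
    rw [hφ]
    exact (b i).2 _ (add_mem_invL g hg x)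
  have h4 : (coinvL g ⊔ φ.ker).toAddSubgroup.index ≤ 2 ^ (24 - r) :=
    index_le_two_pow _ _ le_sup_left _ (by omega) htwo
  have h5 : (coinvL g ⊔ φ.ker).toAddSubgroup.index ≤ 2 ^ r := by
    have hfr : Module.Free ℤ ((Fin 24 → ℤ) ⧸ φ.ker) := Module.Free.of_equiv φ.quotKerEquivRange.symm
    refine index_le_two_pow _ _ le_sup_right _ ?_ htwo
    rw [φ.quotKerEquivRange.finrank_eq]
    simpa using Submodule.finrank_le φ.range
  rw [hJ, mul_comm]
  refine Nat.mul_le_mul h3 ?_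
  rcases le_total r (24 - r) with h | h
  · rwa [min_eq_left h]
  · rwa [min_eq_right h]

end main

/-- If `g` is an isometry of order `2` of `𝐋 = 3U ⊕ 2E8 ⊕ A2` acting non-trivially on the
discriminant group `𝐋^♯`, whose coinvariant sublattice is negative definite and contains no
vector of square `-2` and no vector of square `-4`, then `𝐋_g` has rank `1` and is
generated by a vector `v` with `v·v = -6`. -/
theorem stmt3 (g : (Fin 24 → ℤ) ≃ₗ[ℤ] (Fin 24 → ℤ)) (hiso : IsIsometry g)
    (hord : orderOf g = 2)
    (hnontriv : ¬ ActsTriviallyOnDisc g)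
    (hneg : ∀ v ∈ coinvL g, v ≠ 0 → Bf v v < 0)
    (h2 : ∀ v ∈ coinvL g, Bf v v ≠ -2)
    (h4 : ∀ v ∈ coinvL g, Bf v v ≠ -4) :
    Module.finrank ℤ (coinvL g) = 1 ∧
      ∃ v : Fin 24 → ℤ, Bf v v = -6 ∧ coinvL g = Submodule.span ℤ {v} := by
  have hg : ∀ x, g (g x) = x := by
    intro x
    have h := pow_orderOf_eq_one g
    rw [hord, sq] at h
    exact congrArg (fun f : (Fin 24 → ℤ) ≃ₗ[ℤ] (Fin 24 → ℤ) => f x) h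
  obtain ⟨r, hr⟩ : ∃ r, Module.finrank ℤ (coinvL g) = r := ⟨_, rfl⟩
  let b : Module.Basis (Fin r) ℤ (coinvL g) := Module.finBasisOfFinrankEq ℤ (coinvL g) hr
  have h6 : ∀ v ∈ coinvL g, v ≠ 0 → 6 ≤ - Bf v v := by
    intro v hv hv0
    obtain ⟨k, hk⟩ := Bf_even v
    have := hneg v hv hv0
    have := h2 v hv
    have := h4 v hv
    omega
  have hmin : ∀ x : Fin r → ℤ, x ≠ 0 → 6 ≤ x ⬝ᵥ (coG g b *ᵥ x) := by
    intro x hx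
    rw [coG_form]
    apply h6 _ (Subtype.mem _)
    intro h0
    apply hx
    have h0' : ∑ i, x i • b i = 0 := Subtype.ext h0
    ext i
    exact Fintype.linearIndependent_iff.1 b.linearIndependent x h0' i
  have hdet : (coG g b).det ≠ 0 := by
    intro h
    obtain ⟨v, hv, hv2⟩ := Matrix.exists_mulVec_eq_zero_iff.2 h
    have := hmin v hv
    rw [hv2] at this
    simp at this
  have hle := coG_det_le g hiso hg b hdet
  have hr24 : r ≤ 24 := by
    have := coinvL_finrank_quot g
    omega
  have hr0 : r ≠ 0 := by
    intro h0
    have hbot : coinvL g = ⊥ := Submodule.finrank_eq_zero.1 (hr.trans h0)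
    have : g = 1 := by
      ext1 x
      have := sub_mem_coinvL g hiso x
      rw [hbot, Submodule.mem_bot, sub_eq_zero] at this
      exact this.symm
    rw [this, orderOf_one] at hord
    norm_num at hord
  have hr1 : r = 1 := by
    by_contra hne
    have hb := gram_bound (by omega) (coG g b) (coG_symm g b) hmin
    have hn := numeric r (by omega) hr24
    have hle' : ((coG g b).det : ℝ) ≤ 3 * 2 ^ min r (24 - r) := by
      have h1 : (coG g b).det ≤ ((coG g b).det.natAbs : ℤ) := Int.le_natAbs
      have h2 : (coG g b).det ≤ ((3 * 2 ^ min r (24 - r) : ℕ) : ℤ) :=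
        h1.trans (by exact_mod_cast hle)
      exact_mod_cast h2
    linarith
  clear_value b
  subst hr1
  refine ⟨hr, b 0, ?_, ?_⟩
  · have hb0 : ((b 0 : coinvL g) : Fin 24 → ℤ) ≠ 0 := fun h =>
      b.ne_zero 0 (Subtype.ext h)
    have := h6 _ (b 0).2 hb0
    rw [Matrix.det_fin_one] at hle
    simp only [coG] at hle
    norm_num at hle
    omega
  · apply le_antisymm
    · intro x hx
      have e := congrArg Subtype.val (b.sum_repr ⟨x, hx⟩)
      simp at e
      rw [← e]
      exact Submodule.smul_mem _ _ (Submodule.mem_span_singleton_self _)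
    · rw [Submodule.span_singleton_le_iff_mem]
      exact (b 0).2
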